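/- Let L be a 3-dimensional Lie algebra over a field F with dim [L,L] = 2, and let L = L_α ⊕ L_β be a Lie grading with dim L_α = 2, dim L_β = 1 and [L,L] = ([L,L] ∩ L_α) ⊕ L_β. Then exactly one of the following holds: (i) [L_α, L_α] = L_β and [L_α, L_β] = [L,L] ∩ L_α, in which case the injective map α ↦ 1̄, β ↦ 0̄ into ℤ/2ℤ satisfies property (P); or (ii) [L_α, L_α] ⊆ L_α and [L_α, L_β] = L_β, in which case the injective map α ↦ 0, β ↦ 1 into ℤ satisfies property (P). In either case the grading is a group grading. -/

import Mathlib

/-- The span of all brackets `⁅x, y⁆` with `x ∈ A`, `y ∈ B`: the product `[A, B]`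
of two subspaces of a Lie algebra. -/
def bracketSpan (F : Type*) {L : Type*} [Field F] [LieRing L] [LieAlgebra F L]
    (A B : Submodule F L) : Submodule F L :=
  Submodule.span F {z | ∃ x ∈ A, ∃ y ∈ B, z = ⁅x, y⁆}

/-- A Lie grading of the Lie algebra `L` over `F`: a family of nonzero subspaces,
whose sum is direct and equals `L`, such that for any pair of indices `g, g'` either
`[L_g, L_{g'}] = 0` or `0 ≠ [L_g, L_{g'}] ⊆ L_{g''}` for some index `g''`. -/
def IsLieGrading (F : Type*) {L : Type*} {G : Type*} [Field F] [LieRing L] [LieAlgebra F L]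
    (Lg : G → Submodule F L) : Prop :=
  (∀ g, Lg g ≠ ⊥) ∧ iSupIndep Lg ∧ (⨆ g, Lg g) = ⊤ ∧
    ∀ g g', bracketSpan F (Lg g) (Lg g') = ⊥ ∨
      ∃ g'', bracketSpan F (Lg g) (Lg g') ≠ ⊥ ∧ bracketSpan F (Lg g) (Lg g') ≤ Lg g''

/-- Property (P) for a map `φ` from the index set of a grading into a (multiplicative)
semigroup: `φ g * φ g' = φ g''` whenever `0 ≠ [L_g, L_{g'}] ⊆ L_{g''}`. -/
def PropertyP (F : Type*) {L G S : Type*} [Field F] [LieRing L] [LieAlgebra F L] [Semigroup S]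
    (Lg : G → Submodule F L) (φ : G → S) : Prop :=
  ∀ g g' g'', bracketSpan F (Lg g) (Lg g') ≠ ⊥ → bracketSpan F (Lg g) (Lg g') ≤ Lg g'' →
    φ g * φ g' = φ g''

/-- Property (P) for a map `φ` from the index set of a grading into an additive
semigroup: `φ g + φ g' = φ g''` whenever `0 ≠ [L_g, L_{g'}] ⊆ L_{g''}`. -/
def PropertyPAdd (F : Type*) {L G S : Type*} [Field F] [LieRing L] [LieAlgebra F L]
    [AddSemigroup S] (Lg : G → Submodule F L) (φ : G → S) : Prop :=
  ∀ g g' g'', bracketSpan F (Lg g) (Lg g') ≠ ⊥ → bracketSpan F (Lg g) (Lg g') ≤ Lg g'' →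
    φ g + φ g' = φ g''

section BracketSpan

variable {F L : Type*} [Field F] [LieRing L] [LieAlgebra F L]

theorem lie_mem_bracketSpan {A B : Submodule F L} {x y : L} (hx : x ∈ A) (hy : y ∈ B) :
    ⁅x, y⁆ ∈ bracketSpan F A B :=
  Submodule.subset_span ⟨x, hx, y, hy, rfl⟩

theorem bracketSpan_le {A B C : Submodule F L} :
    bracketSpan F A B ≤ C ↔ ∀ x ∈ A, ∀ y ∈ B, ⁅x, y⁆ ∈ C := by
  refine Submodule.span_le.trans ⟨fun h x hx y hy => h ⟨x, hx, y, hy, rfl⟩, ?_⟩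
  rintro h _ ⟨x, hx, y, hy, rfl⟩
  exact h x hx y hy

theorem bracketSpan_mono {A A' B B' : Submodule F L} (hA : A ≤ A') (hB : B ≤ B') :
    bracketSpan F A B ≤ bracketSpan F A' B' :=
  bracketSpan_le.2 fun _ hx _ hy => lie_mem_bracketSpan (hA hx) (hB hy)

theorem bracketSpan_comm (A B : Submodule F L) : bracketSpan F A B = bracketSpan F B A := by
  have key (A B : Submodule F L) : bracketSpan F A B ≤ bracketSpan F B A :=
    bracketSpan_le.2 fun x hx y hy => by
      rw [← lie_skew]
      exact neg_mem (lie_mem_bracketSpan hy hx)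
  exact le_antisymm (key A B) (key B A)

theorem bracketSpan_self_eq_bot_of_finrank_eq_one {B : Submodule F L}
    (hB : Module.finrank F B = 1) : bracketSpan F B B = ⊥ := by
  obtain ⟨v, -, hv⟩ := finrank_eq_one_iff'.1 hB
  refine le_bot_iff.1 (bracketSpan_le.2 fun x hx y hy => ?_)
  obtain ⟨a, ha⟩ := hv ⟨x, hx⟩
  obtain ⟨b, hb⟩ := hv ⟨y, hy⟩
  obtain rfl : a • (v : L) = x := congrArg Subtype.val ha
  obtain rfl : b • (v : L) = y := congrArg Subtype.val hb
  simp

theorem bracketSpan_top_of_sup_eq_top {A B : Submodule F L} (h : A ⊔ B = ⊤) :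
    bracketSpan F (⊤ : Submodule F L) ⊤ =
      bracketSpan F A A ⊔ bracketSpan F A B ⊔ bracketSpan F B B := by
  refine le_antisymm (bracketSpan_le.2 fun x _ y _ => ?_)
    (sup_le (sup_le ?_ ?_) ?_)
  · obtain ⟨a, ha, b, hb, rfl⟩ := Submodule.mem_sup.1 (h ▸ Submodule.mem_top : x ∈ A ⊔ B)
    obtain ⟨c, hc, d, hd, rfl⟩ := Submodule.mem_sup.1 (h ▸ Submodule.mem_top : y ∈ A ⊔ B)
    have hAA : bracketSpan F A A ≤
        bracketSpan F A A ⊔ bracketSpan F A B ⊔ bracketSpan F B B :=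
      le_sup_left.trans le_sup_left
    have hAB : bracketSpan F A B ≤
        bracketSpan F A A ⊔ bracketSpan F A B ⊔ bracketSpan F B B :=
      le_sup_right.trans le_sup_left
    have hBB : bracketSpan F B B ≤
        bracketSpan F A A ⊔ bracketSpan F A B ⊔ bracketSpan F B B := le_sup_right
    rw [add_lie, lie_add, lie_add]
    refine add_mem (add_mem (hAA (lie_mem_bracketSpan ha hc)) (hAB (lie_mem_bracketSpan ha hd)))
      (add_mem (hAB ?_) (hBB (lie_mem_bracketSpan hb hd)))
    rw [bracketSpan_comm]
    exact lie_mem_bracketSpan hb hc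
  all_goals exact bracketSpan_mono le_top le_top

theorem eq_of_le_of_finrank_eq_one {A B : Submodule F L} (hB : Module.finrank F B = 1)
    (hA : A ≠ ⊥) (hAB : A ≤ B) : A = B := by
  have := Module.finite_of_finrank_eq_succ hB
  have := Submodule.finiteDimensional_of_le hAB
  refine Submodule.eq_of_le_of_finrank_le hAB ?_
  rw [hB]
  exact Submodule.one_le_finrank_iff.2 hA

end BracketSpan

/-- A three-dimensional Lie algebra with two-dimensional derived ideal, graded with two
components of dimensions `2` and `1` such that `[L,L] = ([L,L] ∩ L_α) ⊕ L_β`: then exactly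
one of the two alternatives holds, and in either case a suitable injective map into
`ℤ/2ℤ`, respectively `ℤ`, satisfies property (P), so the grading is a group grading. -/
theorem three_dim_derived_two_case_b
    {F L : Type*} [Field F] [LieRing L] [LieAlgebra F L] [FiniteDimensional F L]
    (hdim : Module.finrank F L = 3)
    (hder : Module.finrank F (bracketSpan F (⊤ : Submodule F L) ⊤) = 2)
    (Lα Lβ : Submodule F L)
    (hgrad : IsLieGrading F ![Lα, Lβ])
    (hdimα : Module.finrank F Lα = 2) (hdimβ : Module.finrank F Lβ = 1)
    (hdecomp : bracketSpan F (⊤ : Submodule F L) ⊤ =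
      (bracketSpan F (⊤ : Submodule F L) ⊤ ⊓ Lα) ⊔ Lβ) :
    Xor'
      (bracketSpan F Lα Lα = Lβ ∧
        bracketSpan F Lα Lβ = bracketSpan F (⊤ : Submodule F L) ⊤ ⊓ Lα)
      (bracketSpan F Lα Lα ≤ Lα ∧ bracketSpan F Lα Lβ = Lβ) ∧
    ((bracketSpan F Lα Lα = Lβ ∧
        bracketSpan F Lα Lβ = bracketSpan F (⊤ : Submodule F L) ⊤ ⊓ Lα) →
      Function.Injective (![1, 0] : Fin 2 → ZMod 2) ∧
      PropertyPAdd F ![Lα, Lβ] (![1, 0] : Fin 2 → ZMod 2)) ∧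
    ((bracketSpan F Lα Lα ≤ Lα ∧ bracketSpan F Lα Lβ = Lβ) →
      Function.Injective (![0, 1] : Fin 2 → ℤ) ∧
      PropertyPAdd F ![Lα, Lβ] (![0, 1] : Fin 2 → ℤ)) := by
  obtain ⟨hne, hind, hsup, hbr⟩ := hgrad
  have hβ0 : Lβ ≠ ⊥ := hne 1
  have hdisj : Disjoint Lα Lβ := hind.pairwiseDisjoint (show (0 : Fin 2) ≠ 1 by decide)
  have htop : Lα ⊔ Lβ = ⊤ := by
    rw [← hsup]
    refine le_antisymm (sup_le (le_iSup ![Lα, Lβ] 0) (le_iSup ![Lα, Lβ] 1)) (iSup_le fun i => ?_)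
    fin_cases i
    · exact le_sup_left
    · exact le_sup_right
  have hββ := bracketSpan_self_eq_bot_of_finrank_eq_one hdimβ
  have hD := bracketSpan_top_of_sup_eq_top htop
  rw [hββ, sup_bot_eq] at hD
  have hβD : Lβ ≤ bracketSpan F Lα Lα ⊔ bracketSpan F Lα Lβ := by
    rw [← hD, hdecomp]
    exact le_sup_right
  have hnβα : ¬ Lβ ≤ Lα := fun h => hβ0 (hdisj.eq_bot_of_ge h)
  have hnDβ : ¬ bracketSpan F Lα Lα ⊔ bracketSpan F Lα Lβ ≤ Lβ := fun h => by
    have := Submodule.finrank_mono h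
    rw [← hD, hder, hdimβ] at this
    omega
  have hle (i j : Fin 2) : bracketSpan F (![Lα, Lβ] i) (![Lα, Lβ] j) ≤ Lα ∨
      bracketSpan F (![Lα, Lβ] i) (![Lα, Lβ] j) ≤ Lβ := by
    rcases hbr i j with h | ⟨k, -, h⟩
    · exact Or.inl (h ▸ bot_le)
    · fin_cases k
      · exact Or.inl h
      · exact Or.inr h
  have hexcl {C : Submodule F L} (hC : C ≠ ⊥) (h1 : C ≤ Lα) (h2 : C ≤ Lβ) : False :=
    hC (le_bot_iff.1 (hdisj h1 h2))
  refine ⟨?_, ?_, ?_⟩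
  · rcases hle 0 1 with hB | hB <;> rcases hle 0 0 with hA | hA <;>
      simp only [Matrix.cons_val_zero, Matrix.cons_val_one] at hA hB
    · exact absurd (hβD.trans (sup_le hA hB)) hnβα
    · have hA0 : bracketSpan F Lα Lα ≠ ⊥ := fun h =>
        hnβα (hβD.trans (sup_le (h ▸ bot_le) hB))
      have hAeq := eq_of_le_of_finrank_eq_one hdimβ hA0 hA
      refine Or.inl ⟨⟨hAeq, ?_⟩, fun h => hnβα (hAeq ▸ h.1)⟩
      rw [hD, hAeq, sup_comm, sup_inf_assoc_of_le _ hB, hdisj.symm.eq_bot, sup_bot_eq]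
    · have hB0 : bracketSpan F Lα Lβ ≠ ⊥ := fun h =>
        hnβα (hβD.trans (sup_le hA (h ▸ bot_le)))
      exact Or.inr ⟨⟨hA, eq_of_le_of_finrank_eq_one hdimβ hB0 hB⟩, fun h => hnβα (h.1 ▸ hA)⟩
    · exact absurd (sup_le hA hB) hnDβ
  · rintro ⟨hA, hB⟩
    have hBα : bracketSpan F Lα Lβ ≤ Lα := hB ▸ inf_le_right
    refine ⟨by decide, fun i j k h0 hk => ?_⟩
    fin_cases i <;> fin_cases j <;> fin_cases k <;>
      simp only [Fin.zero_eta, Fin.mk_one, Matrix.cons_val_zero, Matrix.cons_val_one,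
        bracketSpan_comm Lβ Lα] at h0 hk ⊢ <;>
      first
      | decide
      | exact absurd hββ h0
      | exact (hexcl h0 hBα hk).elim
      | exact (hexcl h0 hk hA.le).elim
  · rintro ⟨hA, hB⟩
    refine ⟨by decide, fun i j k h0 hk => ?_⟩
    fin_cases i <;> fin_cases j <;> fin_cases k <;>
      simp only [Fin.zero_eta, Fin.mk_one, Matrix.cons_val_zero, Matrix.cons_val_one,
        bracketSpan_comm Lβ Lα] at h0 hk ⊢ <;>
      first
      | decide
      | exact absurd hββ h0
      | exact (hexcl h0 hk hB.le).elim
      | exact (hexcl h0 hA hk).elim
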